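/- For every integer n ≥ 1 and every real α with α > 2γ + 16/n, the Lebesgue measure of the set of irrational x ∈ (0,1) with (2/n)·log q_n(x) ≥ α is at most C_α · e^{−I(α)·n}, where C_α = e^{16(|I'(α)|+1)}. -/

import Mathlib

open Filter MeasureTheory Set

/-- The Gauss map `T x = 1/x - ⌊1/x⌋`. -/
noncomputable def gaussMap (x : ℝ) : ℝ := Int.fract (1 / x)

/-- The `(i+1)`-st continued fraction digit `a_{i+1}(x) = ⌊1 / T^i x⌋`. -/
noncomputable def cfDigit (x : ℝ) (i : ℕ) : ℕ := ⌊1 / (gaussMap^[i] x)⌋₊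

/-- Denominators of the convergents: `q_0 = 1`, `q_1 = a_1`, `q_n = a_n q_{n-1} + q_{n-2}`,
given the digit sequence `a` (indexed so that `a i` is the `(i+1)`-st digit). -/
def contDen (a : ℕ → ℕ) : ℕ → ℕ
  | 0 => 1
  | 1 => a 0
  | (n + 2) => a (n + 1) * contDen a (n + 1) + contDen a n

/-- Numerators of the convergents: `p_0 = 0`, `p_1 = 1`, `p_n = a_n p_{n-1} + p_{n-2}`. -/
def contNum (a : ℕ → ℕ) : ℕ → ℕ
  | 0 => 0
  | 1 => 1
  | (n + 2) => a (n + 1) * contNum a (n + 1) + contNum a n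

/-- `q_n(x)`, the denominator of the `n`-th convergent of `x`. -/
noncomputable def qDen (n : ℕ) (x : ℝ) : ℕ := contDen (cfDigit x) n

/-- The level set `L(α)` of the Lyapunov exponent: irrationals `x ∈ (0,1)` with
`liminf (2/n) log q_n(x) = limsup (2/n) log q_n(x) = α`. -/
noncomputable def levelSet (α : EReal) : Set ℝ :=
  {x | x ∈ Set.Ioo (0 : ℝ) 1 ∧ Irrational x ∧
    Filter.liminf (fun n : ℕ => ((2 / (n : ℝ) * Real.log (qDen n x) : ℝ) : EReal))
      Filter.atTop = α ∧
    Filter.limsup (fun n : ℕ => ((2 / (n : ℝ) * Real.log (qDen n x) : ℝ) : EReal))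
      Filter.atTop = α}

/-- `b(α)`, the Hausdorff dimension of the level set `L(α)`. -/
noncomputable def dimSpec (α : ℝ) : ℝ := (dimH (levelSet (α : EReal))).toReal

/-- The rate function `I(α) = α (1 - b(α))`. -/
noncomputable def rateI (α : ℝ) : ℝ := α * (1 - dimSpec α)

/-- Lévy's constant `γ = π² / (12 log 2)`. -/
noncomputable def levyConst : ℝ := Real.pi ^ 2 / (12 * Real.log 2)

/-- `α_min = log ((√5 + 1)/2)`. -/
noncomputable def alphaMin : ℝ := Real.log ((Real.sqrt 5 + 1) / 2)

open scoped Topology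

/-! ### Continuants -/

lemma one_le_contDen {a : ℕ → ℕ} (ha : ∀ i, 1 ≤ a i) : ∀ n, 1 ≤ contDen a n
  | 0 => le_rfl
  | 1 => ha 0
  | (n + 2) => by
    have h1 := one_le_contDen ha (n + 1)
    have h2 := ha (n + 1)
    have := Nat.mul_le_mul h2 h1
    simp only [contDen]
    lia

lemma contDen_le_succ {a : ℕ → ℕ} (ha : ∀ i, 1 ≤ a i) (n : ℕ) :
    contDen a n ≤ contDen a (n + 1) := by
  rcases n with _ | n
  · exact ha 0
  · have := Nat.mul_le_mul (ha (n + 1)) (le_refl (contDen a (n + 1)))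
    simp only [contDen]
    lia

lemma contDen_mono {a : ℕ → ℕ} (ha : ∀ i, 1 ≤ a i) : Monotone (contDen a) :=
  monotone_nat_of_le_succ (contDen_le_succ ha)

lemma contDen_congr {a b : ℕ → ℕ} : ∀ n, (∀ i < n, a i = b i) → contDen a n = contDen b n
  | 0, _ => rfl
  | 1, h => h 0 one_pos
  | (n + 2), h => by
    simp only [contDen]
    rw [h (n + 1) (by lia), contDen_congr (n + 1) fun i hi => h i (by lia),
      contDen_congr n fun i hi => h i (by lia)]

lemma contDen_succ_le {a : ℕ → ℕ} (ha : ∀ i, 1 ≤ a i) (n : ℕ) :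
    contDen a (n + 1) ≤ (a n + 1) * contDen a n := by
  rcases n with _ | n
  · simp [contDen]
  · have := contDen_le_succ ha n
    simp only [contDen]
    lia

lemma contDen_add_le_pow {a : ℕ → ℕ} (ha : ∀ i, 1 ≤ a i) {A : ℕ} (hA : ∀ i, a i ≤ A)
    (n k : ℕ) :
    contDen a (n + k) ≤ (A + 1) ^ k * contDen a n := by
  induction k with
  | zero => simp
  | succ k ih =>
    calc contDen a (n + k + 1) ≤ (a (n + k) + 1) * contDen a (n + k) := contDen_succ_le ha _
      _ ≤ (A + 1) * ((A + 1) ^ k * contDen a n) :=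
        Nat.mul_le_mul (Nat.succ_le_succ (hA _)) ih
      _ = _ := by ring

lemma contDen_mul_le_add {a : ℕ → ℕ} (m : ℕ) :
    ∀ l, contDen a m * contDen (fun i => a (m + i)) l ≤ contDen a (m + l)
  | 0 => by simp [contDen]
  | 1 => by
    rcases m with _ | m
    · simp [contDen]
    · simp only [contDen, add_zero]
      lia
  | (l + 2) => by
    have h1 := contDen_mul_le_add (a := a) m (l + 1)
    have h2 := contDen_mul_le_add (a := a) m l
    have h3 := Nat.mul_le_mul (le_refl (a (m + (l + 1)))) h1
    rw [← add_assoc] at *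
    simp only [contDen]
    rw [← add_assoc] at *
    nlinarith

lemma contDen_add_le {a : ℕ → ℕ} (ha : ∀ i, 1 ≤ a i) (m : ℕ) :
    ∀ l, contDen a (m + l) ≤ 2 * contDen a m * contDen (fun i => a (m + i)) l
  | 0 => by simp only [contDen, add_zero]; lia
  | 1 => by
    have h := contDen_succ_le ha m
    have h1 := Nat.mul_le_mul (show a m + 1 ≤ 2 * a m by have := ha m; lia)
      (le_refl (contDen a m))
    simp only [contDen, add_zero]
    lia
  | (l + 2) => by
    have h1 := contDen_add_le ha m (l + 1)
    have h2 := contDen_add_le ha m l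
    have h3 := Nat.mul_le_mul (le_refl (a (m + (l + 1)))) h1
    rw [← add_assoc] at *
    simp only [contDen]
    rw [← add_assoc] at *
    nlinarith

/-! ### Tails of a continued fraction -/

/-- The sequence `y` consists of the tails `[0; a n, a (n + 1), …]` of the continued fraction with
digits `a`. -/
structure IsTails (a : ℕ → ℕ) (y : ℕ → ℝ) : Prop where
  one_le : ∀ n, 1 ≤ a n
  pos : ∀ n, 0 < y n
  lt_one : ∀ n, y n < 1
  mul_eq : ∀ n, y n * (a n + y (n + 1)) = 1

namespace IsTails

variable {a b : ℕ → ℕ} {y z : ℕ → ℝ}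

lemma prod_mul_eq (h : IsTails a y) (n : ℕ) :
    (contDen a (n + 1) + y (n + 1) * contDen a n) * ∏ i ∈ Finset.range (n + 1), y i = 1 := by
  induction n with
  | zero =>
    have := h.mul_eq 0
    simp [contDen] at *
    linarith
  | succ n ih =>
    have h1 := h.mul_eq (n + 1)
    rw [Finset.prod_range_succ]
    simp only [contDen] at *
    push_cast
    linear_combination ih +
      (contDen a (n + 1) : ℝ) * (∏ i ∈ Finset.range (n + 1), y i) * h1

lemma prod_pos (h : IsTails a y) (n : ℕ) : 0 < ∏ i ∈ Finset.range n, y i :=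
  Finset.prod_pos fun i _ => h.pos i

lemma contDen_pos (h : IsTails a y) (n : ℕ) : (0 : ℝ) < contDen a n := by
  exact_mod_cast one_le_contDen h.one_le n

lemma contDen_mul_prod_le (h : IsTails a y) (n : ℕ) :
    contDen a n * ∏ i ∈ Finset.range n, y i ≤ 1 := by
  rcases n with _ | n
  · simp [contDen]
  · rw [← h.prod_mul_eq n]
    gcongr
    · exact (h.prod_pos _).le
    · have := mul_pos (h.pos (n + 1)) (h.contDen_pos n)
      linarith

lemma one_le_contDen_mul_prod (h : IsTails a y) (n : ℕ) :
    1 ≤ 2 * contDen a n * ∏ i ∈ Finset.range n, y i := by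
  rcases n with _ | n
  · simp [contDen]
  · rw [← h.prod_mul_eq n]
    gcongr
    · exact (h.prod_pos _).le
    · have h1 : (contDen a n : ℝ) ≤ contDen a (n + 1) := by
        exact_mod_cast contDen_le_succ h.one_le n
      nlinarith [h.pos (n + 1), h.lt_one (n + 1), h.contDen_pos n]

lemma abs_sub_eq (ha : IsTails a y) (hb : IsTails b z) (m : ℕ) (hab : ∀ i < m, a i = b i) :
    |y 0 - z 0| = |y m - z m| *
      ((∏ i ∈ Finset.range m, y i) * ∏ i ∈ Finset.range m, z i) := by
  induction m with
  | zero => simp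
  | succ m ih =>
    have h1 : |y m - z m| = |y (m + 1) - z (m + 1)| * (y m * z m) := by
      have e1 := ha.mul_eq m
      have e2 := hb.mul_eq m
      rw [hab m (by lia)] at e1
      have : y m - z m = -(y (m + 1) - z (m + 1)) * (y m * z m) := by
        linear_combination z m * e1 - y m * e2
      rw [this, abs_mul, abs_neg, abs_of_pos (mul_pos (ha.pos m) (hb.pos m))]
    rw [ih fun i hi => hab i (by lia), h1, Finset.prod_range_succ, Finset.prod_range_succ]
    ring

lemma abs_sub_le (ha : IsTails a y) (hb : IsTails b z) (m : ℕ) (hab : ∀ i < m, a i = b i) :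
    |y 0 - z 0| ≤ ((contDen a m : ℝ) ^ 2)⁻¹ := by
  have h1 := ha.contDen_mul_prod_le m
  have h2 := hb.contDen_mul_prod_le m
  rw [← contDen_congr m hab] at h2
  have hq := ha.contDen_pos m
  rw [ha.abs_sub_eq hb m hab]
  have h3 : |y m - z m| ≤ 1 := by
    rw [abs_le]
    constructor <;> linarith [ha.pos m, hb.pos m, ha.lt_one m, hb.lt_one m]
  have e1 : ∏ i ∈ Finset.range m, y i ≤ (contDen a m : ℝ)⁻¹ := by
    rw [← one_div, le_div_iff₀ hq]; linarith
  have e2 : ∏ i ∈ Finset.range m, z i ≤ (contDen a m : ℝ)⁻¹ := by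
    rw [← one_div, le_div_iff₀ hq]; linarith
  have p1 := (ha.prod_pos m).le
  have p2 := (hb.prod_pos m).le
  calc _ ≤ 1 * ((contDen a m : ℝ)⁻¹ * (contDen a m : ℝ)⁻¹) := by gcongr
    _ = _ := by rw [one_mul, ← mul_inv, sq]

lemma inv_le (h : IsTails a y) {A : ℕ} (hA : ∀ i, a i ≤ A) (n : ℕ) : ((A : ℝ) + 1)⁻¹ ≤ y n := by
  have h1 := h.mul_eq n
  have h2 : (a n : ℝ) ≤ A := by exact_mod_cast hA n
  rw [← one_div, div_le_iff₀ (by positivity)]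
  refine h1.symm.le.trans ?_
  have := (h.lt_one (n + 1)).le
  have := h.pos n
  gcongr

lemma le_one_sub (h : IsTails a y) {A : ℕ} (hA : ∀ i, a i ≤ A) (n : ℕ) :
    y n ≤ 1 - ((A : ℝ) + 2)⁻¹ := by
  have h1 := h.mul_eq n
  have h2 : (1 : ℝ) ≤ a n := by exact_mod_cast h.one_le n
  have h3 := h.inv_le hA (n + 1)
  have h4 : y n * (1 + ((A : ℝ) + 1)⁻¹) ≤ 1 := by
    refine le_trans ?_ h1.le
    have := (h.pos n).le
    gcongr
  have : 1 + ((A : ℝ) + 1)⁻¹ = (A + 2) / (A + 1) := by field_simp; ring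
  rw [this, ← mul_div_assoc, div_le_one (by positivity)] at h4
  have h5 : 1 - ((A : ℝ) + 2)⁻¹ = (A + 1) / (A + 2) := by field_simp; ring
  rw [h5, le_div_iff₀ (by positivity)]
  exact h4

lemma le_abs_sub (ha : IsTails a y) (hb : IsTails b z) {A : ℕ} (hA : ∀ i, a i ≤ A)
    (hB : ∀ i, b i ≤ A) {m : ℕ} (hab : ∀ i < m, a i = b i) (hne : a m ≠ b m) :
    (4 * ((A : ℝ) + 1) ^ 2 * (A + 2))⁻¹ * ((contDen a m : ℝ) ^ 2)⁻¹ ≤ |y 0 - z 0| := by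
  have h1 := ha.one_le_contDen_mul_prod m
  have h2 := hb.one_le_contDen_mul_prod m
  rw [← contDen_congr m hab] at h2
  have hq := ha.contDen_pos m
  rw [ha.abs_sub_eq hb m hab]
  have e1 : (2 * contDen a m : ℝ)⁻¹ ≤ ∏ i ∈ Finset.range m, y i := by
    rw [← one_div, div_le_iff₀ (by positivity)]; linarith
  have e2 : (2 * contDen a m : ℝ)⁻¹ ≤ ∏ i ∈ Finset.range m, z i := by
    rw [← one_div, div_le_iff₀ (by positivity)]; linarith
  have p1 := (ha.prod_pos m).le
  have h3 : ((A : ℝ) + 2)⁻¹ ≤ |(b m + z (m + 1)) - (a m + y (m + 1))| := by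
    have i1 := ha.le_one_sub hA (m + 1)
    have i2 := hb.le_one_sub hB (m + 1)
    have i3 := ha.pos (m + 1)
    have i4 := hb.pos (m + 1)
    rcases lt_or_gt_of_ne hne with h | h
    · have : (a m : ℝ) + 1 ≤ b m := by exact_mod_cast h
      exact le_trans (by linarith) (le_abs_self _)
    · have : (b m : ℝ) + 1 ≤ a m := by exact_mod_cast h
      exact le_trans (by linarith) (neg_le_abs _)
  have h4 : ((A : ℝ) + 2)⁻¹ * (((A : ℝ) + 1)⁻¹ * ((A : ℝ) + 1)⁻¹) ≤ |y m - z m| := by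
    have e : y m - z m = ((b m + z (m + 1)) - (a m + y (m + 1))) * (y m * z m) := by
      linear_combination z m * ha.mul_eq m - y m * hb.mul_eq m
    have i1 := ha.inv_le hA m
    have i2 := hb.inv_le hB m
    have := (ha.pos m).le
    rw [e, abs_mul, abs_of_pos (mul_pos (ha.pos m) (hb.pos m))]
    gcongr
  calc _ = (((A : ℝ) + 2)⁻¹ * (((A : ℝ) + 1)⁻¹ * ((A : ℝ) + 1)⁻¹)) *
        ((2 * contDen a m : ℝ)⁻¹ * (2 * contDen a m : ℝ)⁻¹) := by
        field_simp; norm_num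
    _ ≤ _ := by gcongr

end IsTails

lemma exists_tails_upto (N : ℕ) : ∀ {a : ℕ → ℕ}, (∀ i, 1 ≤ a i) → ∃ y : ℕ → ℝ,
    (∀ n, y n ∈ Icc (0 : ℝ) 1) ∧ ∀ n < N, y n * (a n + y (n + 1)) = 1 := by
  induction N with
  | zero => exact fun _ => ⟨fun _ => 0, by simp, by simp⟩
  | succ N ih =>
    intro a ha
    obtain ⟨z, hz, hz'⟩ := ih (a := fun i => a (i + 1)) fun i => ha _
    have h1 : (1 : ℝ) ≤ a 0 := by exact_mod_cast ha 0
    have h2 := (hz 0).1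
    refine ⟨fun n => Nat.casesOn n ((a 0 + z 0)⁻¹) z, ?_, ?_⟩
    · rintro (_ | n)
      · exact ⟨inv_nonneg.2 (by linarith), inv_le_one_of_one_le₀ (by linarith)⟩
      · exact hz n
    · rintro (_ | n) hn
      · exact inv_mul_cancel₀ (show (0 : ℝ) < a 0 + z 0 by linarith).ne'
      · exact hz' n (by lia)

lemma exists_isTails {a : ℕ → ℕ} (ha : ∀ i, 1 ≤ a i) : ∃ y, IsTails a y := by
  let K : ℕ → Set (ℕ → ℝ) := fun N =>
    (Set.univ.pi fun _ => Icc (0 : ℝ) 1) ∩ ⋂ n ∈ Finset.range N, {y | y n * (a n + y (n + 1)) = 1}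
  have hcl : ∀ N, IsClosed (⋂ n ∈ Finset.range N, {y : ℕ → ℝ | y n * (a n + y (n + 1)) = 1}) :=
    fun N => isClosed_biInter fun n _ => isClosed_eq (by fun_prop) (by fun_prop)
  have hc : IsCompact (Set.univ.pi fun _ : ℕ => Icc (0 : ℝ) 1) :=
    isCompact_univ_pi fun _ => isCompact_Icc
  obtain ⟨y, hy⟩ := IsCompact.nonempty_iInter_of_sequence_nonempty_isCompact_isClosed K
    (fun N => by
      refine inter_subset_inter_right _ (biInter_mono ?_ fun _ _ => subset_rfl)
      exact fun i hi => Finset.mem_range.2 ((Finset.mem_range.1 hi).trans N.lt_succ_self))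
    (fun N => by
      obtain ⟨y, hy, hy'⟩ := exists_tails_upto N ha
      exact ⟨y, fun n _ => hy n, by simpa using hy'⟩)
    (hc.inter_right (hcl 0)) (fun N => hc.isClosed.inter (hcl N))
  rw [mem_iInter] at hy
  have h0 : ∀ n, y n ∈ Icc (0 : ℝ) 1 := fun n => (hy 0).1 n (mem_univ n)
  have h1 : ∀ n, y n * (a n + y (n + 1)) = 1 := by
    intro n
    have := (hy (n + 1)).2
    simp only [mem_iInter, Finset.mem_range] at this
    exact this n n.lt_succ_self
  have hp : ∀ n, 0 < y n := fun n =>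
    (h0 n).1.lt_of_ne fun h => by have := h1 n; rw [← h] at this; simp at this
  refine ⟨y, ha, hp, fun n => ?_, h1⟩
  have h2 : (1 : ℝ) ≤ a n := by exact_mod_cast ha n
  nlinarith [h1 n, hp n, hp (n + 1)]

/-! ### The Gauss map -/

lemma exists_iterate_gaussMap_div_eq_zero (p : ℕ) :
    ∀ q : ℕ, ∃ i, gaussMap^[i] ((p : ℝ) / q) = 0 := by
  induction p using Nat.strong_induction_on with
  | _ p ih =>
    intro q
    rcases Nat.eq_zero_or_pos p with rfl | hp
    · exact ⟨0, by simp⟩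
    · obtain ⟨i, hi⟩ := ih (q % p) (Nat.mod_lt _ hp) p
      refine ⟨i + 1, ?_⟩
      rw [Function.iterate_succ_apply]
      have : gaussMap ((p : ℝ) / q) = ((q % p : ℕ) : ℝ) / p := by
        rw [gaussMap, one_div_div, Int.fract_div_natCast_eq_div_natCast_mod]
      rw [this, hi]

namespace IsTails

variable {a : ℕ → ℕ} {y : ℕ → ℝ}

lemma one_div_eq (h : IsTails a y) (n : ℕ) : 1 / y n = a n + y (n + 1) := by
  rw [div_eq_iff (h.pos n).ne', mul_comm, h.mul_eq]

lemma iterate_gaussMap (h : IsTails a y) (n : ℕ) : gaussMap^[n] (y 0) = y n := by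
  induction n with
  | zero => rfl
  | succ n ih =>
    rw [Function.iterate_succ_apply', ih, gaussMap, h.one_div_eq, Int.fract_natCast_add,
      Int.fract_eq_self.2 ⟨(h.pos _).le, h.lt_one _⟩]

lemma cfDigit_eq (h : IsTails a y) : cfDigit (y 0) = a := by
  funext n
  rw [cfDigit, h.iterate_gaussMap, h.one_div_eq, Nat.floor_eq_iff]
  · constructor <;> linarith [h.pos (n + 1), h.lt_one (n + 1)]
  · exact add_nonneg (Nat.cast_nonneg _) (h.pos _).le

lemma irrational (h : IsTails a y) : Irrational (y 0) := by
  rintro ⟨r, hr⟩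
  have hr0 : 0 ≤ r := by
    have := h.pos 0
    rw [← hr] at this
    exact_mod_cast this.le
  obtain ⟨i, hi⟩ := exists_iterate_gaussMap_div_eq_zero r.num.toNat r.den
  have e : ((r.num.toNat : ℕ) : ℝ) / r.den = y 0 := by
    have h1 : ((r.num.toNat : ℕ) : ℝ) = (r.num : ℝ) := by
      exact_mod_cast Int.toNat_of_nonneg (Rat.num_nonneg.2 hr0)
    rw [← hr, h1]
    exact_mod_cast Rat.num_div_den r
  rw [e, h.iterate_gaussMap] at hi
  exact (h.pos i).ne' hi

end IsTails

lemma gaussMap_mem {x : ℝ} (hx : Irrational x) : gaussMap x ∈ Ioo (0 : ℝ) 1 ∧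
    Irrational (gaussMap x) := by
  have h1 : Irrational (1 / x) := by simpa using hx.inv
  have h2 : Irrational (gaussMap x) := by
    rw [gaussMap, Int.fract]; exact h1.sub_intCast _
  exact ⟨⟨(Int.fract_nonneg _).lt_of_ne h2.ne_zero.symm, Int.fract_lt_one _⟩, h2⟩

lemma iterate_gaussMap_mem {x : ℝ} (hx : x ∈ Ioo (0 : ℝ) 1) (hx' : Irrational x) (n : ℕ) :
    gaussMap^[n] x ∈ Ioo (0 : ℝ) 1 ∧ Irrational (gaussMap^[n] x) := by
  induction n with
  | zero => exact ⟨hx, hx'⟩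
  | succ n ih =>
    rw [Function.iterate_succ_apply']
    exact gaussMap_mem ih.2

lemma isTails_cfDigit {x : ℝ} (hx : x ∈ Ioo (0 : ℝ) 1) (hx' : Irrational x) :
    IsTails (cfDigit x) fun n => gaussMap^[n] x := by
  have h := fun n => (iterate_gaussMap_mem hx hx' n).1
  refine ⟨fun n => ?_, fun n => (h n).1, fun n => (h n).2, fun n => ?_⟩
  · rw [cfDigit, Nat.one_le_floor_iff, le_div_iff₀ (h n).1]
    linarith [(h n).2]
  · have h0 := (h n).1
    rw [Function.iterate_succ_apply', gaussMap, cfDigit,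
      natCast_floor_eq_intCast_floor (by positivity), Int.floor_add_fract,
      mul_one_div_cancel h0.ne']

/-! ### Lower bounds for the Hausdorff dimension of a Cantor set of continued fractions -/

lemma le_dimH_image_of_abs_sub_le {x : ℝ → ℝ} {C r : ℝ} (hr : 0 < r)
    (h : ∀ t ∈ Ico (0 : ℝ) 1, ∀ t' ∈ Ico (0 : ℝ) 1, |t - t'| ≤ C * |x t - x t'| ^ r) :
    ENNReal.ofReal r ≤ dimH (x '' Ico (0 : ℝ) 1) := by
  have hinj : InjOn x (Ico (0 : ℝ) 1) := by
    intro t ht t' ht' e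
    have := h t ht t' ht'
    rw [e, sub_self, abs_zero, Real.zero_rpow hr.ne', mul_zero] at this
    exact sub_eq_zero.1 (abs_nonpos_iff.1 this)
  have hf := hinj.leftInvOn_invFunOn
  have hH : HolderOnWith C.toNNReal r.toNNReal (Function.invFunOn x (Ico (0 : ℝ) 1))
      (x '' Ico (0 : ℝ) 1) := by
    rintro _ ⟨t, ht, rfl⟩ _ ⟨t', ht', rfl⟩
    rw [hf ht, hf ht', edist_dist, edist_dist, Real.dist_eq, Real.dist_eq,
      Real.coe_toNNReal _ hr.le, ENNReal.ofReal_rpow_of_nonneg (abs_nonneg _) hr.le]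
    change _ ≤ ENNReal.ofReal C * _
    rw [← ENNReal.ofReal_mul' (by positivity)]
    exact ENNReal.ofReal_le_ofReal (h t ht t' ht')
  have h1 := hH.dimH_image_le (Real.toNNReal_pos.2 hr)
  rw [hf.image_image, Real.dimH_of_nonempty_interior
    (by rw [interior_Ico]; exact nonempty_Ioo.2 one_pos)] at h1
  have h2 : ENNReal.ofReal r ≠ 0 := by simpa using hr
  have := (ENNReal.le_div_iff_mul_le (Or.inl h2) (Or.inl ENNReal.ofReal_ne_top)).1 h1
  simpa using this

lemma exists_partition {ι : Type*} [Inhabited ι] (W : Finset ι) {p : ι → ℝ} (hp : ∀ w, 0 < p w) :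
    ∃ (φ : ℝ → ι) (ψ : ℝ → ℝ), ∀ t ∈ Ico 0 (∑ w ∈ W, p w), φ t ∈ W ∧ ψ t ∈ Ico (0 : ℝ) 1 ∧
      ∀ t' ∈ Ico 0 (∑ w ∈ W, p w), φ t = φ t' → |t - t'| ≤ p (φ t) * |ψ t - ψ t'| := by
  classical
  induction W using Finset.induction_on with
  | empty => exact ⟨fun _ => default, id, by simp⟩
  | insert b W hb ih =>
    obtain ⟨φ, ψ, h⟩ := ih
    rw [Finset.sum_insert hb]
    set S := ∑ w ∈ W, p w
    refine ⟨fun t => if t < S then φ t else b, fun t => if t < S then ψ t else (t - S) / p b,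
      fun t ht => ?_⟩
    by_cases h1 : t < S
    · obtain ⟨i1, i2, i3⟩ := h t ⟨ht.1, h1⟩
      simp only [h1, if_true]
      refine ⟨Finset.mem_insert_of_mem i1, i2, fun t' ht' e => ?_⟩
      by_cases h2 : t' < S
      · simp only [h2, if_true] at e ⊢
        exact i3 t' ⟨ht'.1, h2⟩ e
      · simp only [h2, if_false] at e
        exact absurd (e ▸ i1) hb
    · simp only [h1, if_false]
      refine ⟨Finset.mem_insert_self _ _, ⟨?_, ?_⟩, fun t' ht' e => ?_⟩
      · exact div_nonneg (by linarith) (hp b).le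
      · rw [div_lt_one (hp b)]
        linarith [ht.2]
      · by_cases h2 : t' < S
        · simp only [h2, if_true] at e
          exact absurd (e ▸ (h t' ⟨ht'.1, h2⟩).1) hb
        · simp only [h2, if_false]
          rw [← sub_div, abs_div, abs_of_pos (hp b), mul_div_cancel₀ _ (hp b).ne']
          apply le_of_eq
          congr 1
          ring

/-- A finite family of words of the same length, a word being represented by the digits of an
infinite sequence at indices less than `len`. -/
structure WordFamily (c : ℝ) where
  /-- The common length of the words. -/
  len : ℕ
  /-- The words. -/
  words : Finset (ℕ → ℕ)
  len_pos : 1 ≤ len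
  one_le : ∀ w ∈ words, ∀ i, 1 ≤ w i
  ext_words : ∀ w ∈ words, ∀ w' ∈ words, (∀ i < len, w i = w' i) → w = w'
  sum_le : 4 * Real.exp (-(c * len)) ≤ ∑ w ∈ words, ((contDen w len : ℝ) ^ 2)⁻¹

namespace WordFamily

variable {c : ℝ} (F : WordFamily c)

/-- The weight of a word, proportional to the inverse square of its continuant. -/
noncomputable def weight (w : ℕ → ℕ) : ℝ :=
  ((max 1 (contDen w F.len) : ℝ) ^ 2)⁻¹ * (Real.exp (c * F.len) / 4)

lemma exists_partition_Ico : ∃ (φ : ℝ → ℕ → ℕ) (ψ : ℝ → ℝ), ∀ t ∈ Ico (0 : ℝ) 1,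
    φ t ∈ F.words ∧ ψ t ∈ Ico (0 : ℝ) 1 ∧
      ∀ t' ∈ Ico (0 : ℝ) 1, φ t = φ t' → |t - t'| ≤ F.weight (φ t) * |ψ t - ψ t'| := by
  obtain ⟨φ, ψ, h⟩ := exists_partition F.words (p := F.weight) fun w => by
    unfold weight; positivity
  have hs : 1 ≤ ∑ w ∈ F.words, F.weight w := by
    have e : ∑ w ∈ F.words, F.weight w =
        (∑ w ∈ F.words, ((contDen w F.len : ℝ) ^ 2)⁻¹) * (Real.exp (c * F.len) / 4) := by
      rw [Finset.sum_mul]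
      refine Finset.sum_congr rfl fun w hw => ?_
      rw [weight, max_eq_right]
      exact_mod_cast one_le_contDen (F.one_le w hw) _
    rw [e]
    calc (1 : ℝ) = 4 * Real.exp (-(c * F.len)) * (Real.exp (c * F.len) / 4) := by
          rw [Real.exp_neg]; field_simp
      _ ≤ _ := by
        gcongr
        exact F.sum_le
  have hm : ∀ t ∈ Ico (0 : ℝ) 1, t ∈ Ico 0 (∑ w ∈ F.words, F.weight w) := fun t ht =>
    ⟨ht.1, ht.2.trans_le hs⟩
  exact ⟨φ, ψ, fun t ht => ⟨(h t (hm t ht)).1, (h t (hm t ht)).2.1,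
    fun t' ht' => (h t (hm t ht)).2.2 t' (hm t' ht')⟩⟩

/-- The word of the family encoded by a number in `[0, 1)`. -/
noncomputable def word : ℝ → ℕ → ℕ := F.exists_partition_Ico.choose

/-- The rescaled position of a number in `[0, 1)` inside the interval encoding its word. -/
noncomputable def rest : ℝ → ℝ := F.exists_partition_Ico.choose_spec.choose

lemma word_mem {t : ℝ} (ht : t ∈ Ico (0 : ℝ) 1) : F.word t ∈ F.words :=
  (F.exists_partition_Ico.choose_spec.choose_spec t ht).1

lemma rest_mem {t : ℝ} (ht : t ∈ Ico (0 : ℝ) 1) : F.rest t ∈ Ico (0 : ℝ) 1 :=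
  (F.exists_partition_Ico.choose_spec.choose_spec t ht).2.1

lemma abs_sub_le {t t' : ℝ} (ht : t ∈ Ico (0 : ℝ) 1) (ht' : t' ∈ Ico (0 : ℝ) 1)
    (h : F.word t = F.word t') :
    |t - t'| ≤ ((contDen (F.word t) F.len : ℝ) ^ 2)⁻¹ * (Real.exp (c * F.len) / 4) *
      |F.rest t - F.rest t'| := by
  have := (F.exists_partition_Ico.choose_spec.choose_spec t ht).2.2 t' ht' h
  change _ ≤ F.weight (F.word t) * |F.rest t - F.rest t'| at this
  rw [weight, max_eq_right] at this
  · exact this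
  · exact_mod_cast one_le_contDen (F.one_le _ (F.word_mem ht)) _

lemma exists_digit_le : ∃ A : ℕ, ∀ w ∈ F.words, ∀ i < F.len, w i ≤ A :=
  ⟨∑ w ∈ F.words, ∑ i ∈ Finset.range F.len, w i, fun w hw _ hi =>
    (Finset.single_le_sum (f := fun i => w i) (fun _ _ => Nat.zero_le _)
      (Finset.mem_range.2 hi)).trans
    (Finset.single_le_sum (f := fun w => ∑ i ∈ Finset.range F.len, w i)
      (fun _ _ => Nat.zero_le _) hw)⟩

lemma exists_contDen_le : ∃ B : ℕ, ∀ w ∈ F.words, contDen w F.len ≤ B :=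
  ⟨∑ w ∈ F.words, contDen w F.len, fun _ hw =>
    Finset.single_le_sum (f := fun w => contDen w F.len) (fun _ _ => Nat.zero_le _) hw⟩

end WordFamily

/-- The sequence with the first `m` digits of `a`, followed by `w`. -/
def splice (m : ℕ) (a w : ℕ → ℕ) (i : ℕ) : ℕ := if i < m then a i else w (i - m)

lemma splice_of_lt {m i : ℕ} (a w : ℕ → ℕ) (h : i < m) : splice m a w i = a i := if_pos h

lemma splice_add (m : ℕ) (a w : ℕ → ℕ) (i : ℕ) : splice m a w (m + i) = w i := by
  simp [splice]

section Coding

variable {c : ℝ} (Φ : ℕ × (ℕ → ℕ) → WordFamily c)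

/-- Append to a prefix the word, from the family assigned by `Φ` to this prefix, encoded by the
second component. -/
noncomputable def appendWord (σ : (ℕ × (ℕ → ℕ)) × ℝ) : (ℕ × (ℕ → ℕ)) × ℝ :=
  ((σ.1.1 + (Φ σ.1).len, splice σ.1.1 σ.1.2 ((Φ σ.1).word σ.2)), (Φ σ.1).rest σ.2)

/-- The prefix obtained from `t` after appending `k` words, together with the remaining number. -/
noncomputable def coding (t : ℝ) (k : ℕ) : (ℕ × (ℕ → ℕ)) × ℝ :=
  (appendWord Φ)^[k] ((0, fun _ => 1), t)

/-- The infinite digit sequence encoded by `t`. -/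
noncomputable def codeSeq (t : ℝ) (i : ℕ) : ℕ := (coding Φ t (i + 1)).1.2 i

lemma coding_succ (t : ℝ) (k : ℕ) : coding Φ t (k + 1) = appendWord Φ (coding Φ t k) :=
  Function.iterate_succ_apply' _ _ _

variable {Φ} {t t' : ℝ}

lemma coding_snd_mem (ht : t ∈ Ico (0 : ℝ) 1) (k : ℕ) : (coding Φ t k).2 ∈ Ico (0 : ℝ) 1 := by
  induction k with
  | zero => exact ht
  | succ k ih => rw [coding_succ]; exact (Φ _).rest_mem ih

lemma coding_len_succ (t : ℝ) (k : ℕ) :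
    (coding Φ t (k + 1)).1.1 = (coding Φ t k).1.1 + (Φ (coding Φ t k).1).len := by
  rw [coding_succ, appendWord]

lemma coding_len_strictMono (t : ℝ) : StrictMono fun k => (coding Φ t k).1.1 :=
  strictMono_nat_of_lt_succ fun k => by
    have := (Φ (coding Φ t k).1).len_pos
    simp only [coding_len_succ]
    lia

lemma coding_one_le (ht : t ∈ Ico (0 : ℝ) 1) (k : ℕ) : ∀ i, 1 ≤ (coding Φ t k).1.2 i := by
  induction k with
  | zero => exact fun _ => le_rfl
  | succ k ih =>
    intro i
    rw [coding_succ, appendWord]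
    simp only [splice]
    split_ifs
    · exact ih i
    · exact (Φ _).one_le _ ((Φ _).word_mem (coding_snd_mem ht k)) _

lemma coding_eq_of_le {k l i : ℕ} (hkl : k ≤ l) (hi : i < (coding Φ t k).1.1) :
    (coding Φ t l).1.2 i = (coding Φ t k).1.2 i := by
  induction l, hkl using Nat.le_induction with
  | base => rfl
  | succ l hl ih =>
    rw [coding_succ, appendWord, ← ih]
    exact splice_of_lt _ _ (hi.trans_le ((coding_len_strictMono t).monotone hl))

lemma codeSeq_eq {k i : ℕ} (hi : i < (coding Φ t k).1.1) :
    codeSeq Φ t i = (coding Φ t k).1.2 i := by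
  rcases le_total (i + 1) k with h | h
  · exact (coding_eq_of_le h (by
      have := (coding_len_strictMono (Φ := Φ) t).le_apply (x := i + 1)
      lia)).symm
  · exact coding_eq_of_le h hi

lemma codeSeq_add {k i : ℕ} (hi : i < (Φ (coding Φ t k).1).len) :
    codeSeq Φ t ((coding Φ t k).1.1 + i) = (Φ (coding Φ t k).1).word (coding Φ t k).2 i := by
  rw [codeSeq_eq (k := k + 1) (by rw [coding_len_succ]; lia), coding_succ, appendWord]
  exact splice_add _ _ _ _

lemma codeSeq_one_le (ht : t ∈ Ico (0 : ℝ) 1) (i : ℕ) : 1 ≤ codeSeq Φ t i :=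
  coding_one_le ht _ _

lemma exists_coding_between (t : ℝ) (i : ℕ) :
    ∃ k, (coding Φ t k).1.1 ≤ i ∧ i < (coding Φ t (k + 1)).1.1 := by
  induction i with
  | zero => exact ⟨0, le_rfl, by
      have := coding_len_strictMono (Φ := Φ) t (Nat.lt_succ_self 0)
      simp only at this
      lia⟩
  | succ i ih =>
    obtain ⟨k, h1, h2⟩ := ih
    rcases lt_or_ge (i + 1) (coding Φ t (k + 1)).1.1 with h | h
    · exact ⟨k, h1.trans (Nat.le_succ i), h⟩
    · exact ⟨k + 1, h, by
        have := coding_len_strictMono (Φ := Φ) t (Nat.lt_succ_self (k + 1))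
        simp only at this
        lia⟩

lemma codeSeq_le {A : ℕ} (hA : ∀ σ, ∀ w ∈ (Φ σ).words, ∀ i < (Φ σ).len, w i ≤ A)
    (ht : t ∈ Ico (0 : ℝ) 1) (i : ℕ) : codeSeq Φ t i ≤ A := by
  obtain ⟨k, h1, h2⟩ := exists_coding_between (Φ := Φ) t i
  obtain ⟨j, rfl⟩ := Nat.exists_eq_add_of_le h1
  rw [coding_len_succ] at h2
  rw [codeSeq_add (by lia)]
  exact hA _ _ ((Φ _).word_mem (coding_snd_mem ht k)) _ (by lia)

lemma contDen_codeSeq (t : ℝ) (k : ℕ) :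
    contDen (codeSeq Φ t) (coding Φ t k).1.1 = contDen (coding Φ t k).1.2 (coding Φ t k).1.1 :=
  contDen_congr _ fun _ hi => codeSeq_eq hi

lemma contDen_shift_codeSeq (t : ℝ) (k : ℕ) :
    contDen (fun i => codeSeq Φ t ((coding Φ t k).1.1 + i)) (Φ (coding Φ t k).1).len =
      contDen ((Φ (coding Φ t k).1).word (coding Φ t k).2) (Φ (coding Φ t k).1).len :=
  contDen_congr _ fun _ hi => codeSeq_add hi

lemma contDen_codeSeq_succ_le (ht : t ∈ Ico (0 : ℝ) 1) (k : ℕ) :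
    contDen (codeSeq Φ t) (coding Φ t (k + 1)).1.1 ≤
      2 * contDen (codeSeq Φ t) (coding Φ t k).1.1 *
      contDen ((Φ (coding Φ t k).1).word (coding Φ t k).2) (Φ (coding Φ t k).1).len := by
  rw [coding_len_succ, ← contDen_shift_codeSeq]
  exact contDen_add_le (codeSeq_one_le ht) _ _

lemma le_contDen_codeSeq_succ (k : ℕ) :
    contDen (codeSeq Φ t) (coding Φ t k).1.1 *
      contDen ((Φ (coding Φ t k).1).word (coding Φ t k).2) (Φ (coding Φ t k).1).len ≤
      contDen (codeSeq Φ t) (coding Φ t (k + 1)).1.1 := by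
  rw [coding_len_succ, ← contDen_shift_codeSeq]
  exact contDen_mul_le_add _ _

lemma abs_sub_le_of_coding_eq (ht : t ∈ Ico (0 : ℝ) 1) (ht' : t' ∈ Ico (0 : ℝ) 1) :
    ∀ k, (coding Φ t k).1 = (coding Φ t' k).1 →
      (∀ j < k, (coding Φ t j).1 = (coding Φ t' j).1 ∧
        (Φ (coding Φ t j).1).word (coding Φ t j).2 =
          (Φ (coding Φ t j).1).word (coding Φ t' j).2) →
      |t - t'| ≤ ((contDen (codeSeq Φ t) (coding Φ t k).1.1 : ℝ) ^ 2)⁻¹ *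
        Real.exp (c * (coding Φ t k).1.1) * |(coding Φ t k).2 - (coding Φ t' k).2| := by
  intro k
  induction k with
  | zero => intro _ _; simp [coding, contDen]
  | succ k ih =>
    intro _ hw
    obtain ⟨e, hwk⟩ := hw k k.lt_succ_self
    have h1 := ih e fun j hj => hw j (hj.trans k.lt_succ_self)
    have h2 := (Φ (coding Φ t k).1).abs_sub_le (coding_snd_mem ht k) (coding_snd_mem ht' k) hwk
    have e1 : (Φ (coding Φ t k).1).rest (coding Φ t k).2 = (coding Φ t (k + 1)).2 := by
      rw [coding_succ, appendWord]
    have e2 : (Φ (coding Φ t k).1).rest (coding Φ t' k).2 = (coding Φ t' (k + 1)).2 := by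
      rw [coding_succ, appendWord, e]
    rw [e1, e2] at h2
    have h3 := contDen_codeSeq_succ_le (Φ := Φ) ht k
    have p0 := one_le_contDen (codeSeq_one_le (Φ := Φ) ht) (coding Φ t (k + 1)).1.1
    have p1 := one_le_contDen (codeSeq_one_le (Φ := Φ) ht) (coding Φ t k).1.1
    have p2 := one_le_contDen ((Φ (coding Φ t k).1).one_le _
      ((Φ (coding Φ t k).1).word_mem (coding_snd_mem (Φ := Φ) ht k))) (Φ (coding Φ t k).1).len
    rw [coding_len_succ] at *
    generalize contDen (codeSeq Φ t) ((coding Φ t k).1.1 + (Φ (coding Φ t k).1).len) = Q at *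
    generalize contDen (codeSeq Φ t) (coding Φ t k).1.1 = q at *
    generalize contDen ((Φ (coding Φ t k).1).word (coding Φ t k).2)
      (Φ (coding Φ t k).1).len = r at *
    have h3' : (Q : ℝ) ≤ 2 * q * r := by exact_mod_cast h3
    have p0' : (0 : ℝ) < Q := by exact_mod_cast p0
    have p1' : (0 : ℝ) < q := by exact_mod_cast p1
    have p2' : (0 : ℝ) < r := by exact_mod_cast p2
    have h4 : ((q : ℝ) ^ 2)⁻¹ * (((r : ℝ) ^ 2)⁻¹ / 4) ≤ ((Q : ℝ) ^ 2)⁻¹ := by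
      calc _ = ((2 * q * r : ℝ) ^ 2)⁻¹ := by field_simp; norm_num
        _ ≤ _ := by gcongr
    push_cast
    rw [mul_add, Real.exp_add]
    calc |t - t'| ≤ _ := h1
      _ ≤ _ := mul_le_mul_of_nonneg_left h2 (by positivity)
      _ = ((q : ℝ) ^ 2)⁻¹ * (((r : ℝ) ^ 2)⁻¹ / 4) * (Real.exp (c * (coding Φ t k).1.1) *
          Real.exp (c * (Φ (coding Φ t k).1).len)) *
          |(coding Φ t (k + 1)).2 - (coding Φ t' (k + 1)).2| := by ring
      _ ≤ _ := by gcongr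

end Coding

section Steering

variable {α s : ℝ} (E G : WordFamily (s * α))

/-- Use words of `E` after prefixes of exponent less than `α`, and words of `G` after the other
prefixes. -/
noncomputable def steer (σ : ℕ × (ℕ → ℕ)) : WordFamily (s * α) :=
  if 2 * Real.log (contDen σ.2 σ.1) < α * σ.1 then E else G

lemma steer_eq_or (σ : ℕ × (ℕ → ℕ)) : steer E G σ = E ∨ steer E G σ = G := by
  unfold steer
  split_ifs <;> simp

variable {E G}

lemma exists_abs_log_contDen_sub_le (hα : 0 < α)
    (hE : ∀ w ∈ E.words, α * E.len ≤ 2 * Real.log (contDen w E.len))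
    (hG : ∀ w ∈ G.words, 2 * Real.log (contDen w G.len) + Real.log 4 ≤ α * G.len) :
    ∃ B : ℝ, ∀ t ∈ Ico (0 : ℝ) 1, ∀ k,
      |2 * Real.log (contDen (codeSeq (steer E G) t) (coding (steer E G) t k).1.1) -
        α * (coding (steer E G) t k).1.1| ≤ B := by
  obtain ⟨B, hB⟩ := E.exists_contDen_le
  set M : ℝ := 2 * Real.log B + Real.log 4 + α * G.len with hM
  have hB0 : 0 ≤ Real.log B := Real.log_natCast_nonneg B
  have h4 : 0 ≤ Real.log 4 := Real.log_nonneg (by norm_num)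
  have hG0 : 0 ≤ α * G.len := by positivity
  refine ⟨M, fun t ht k => ?_⟩
  rw [abs_le]
  induction k with
  | zero => simp [coding, contDen]; linarith
  | succ k ih =>
    set a := codeSeq (steer E G) t
    set σ := coding (steer E G) t k with hσ
    have hw := (steer E G σ.1).word_mem (coding_snd_mem (Φ := steer E G) ht k)
    rw [← hσ] at hw
    have h1 := contDen_codeSeq_succ_le (Φ := steer E G) ht k
    have h2 := le_contDen_codeSeq_succ (Φ := steer E G) (t := t) k
    have p0 := one_le_contDen (codeSeq_one_le (Φ := steer E G) ht)
      (coding (steer E G) t (k + 1)).1.1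
    have p1 := one_le_contDen (codeSeq_one_le (Φ := steer E G) ht) σ.1.1
    have p2 := one_le_contDen ((steer E G σ.1).one_le _ hw) (steer E G σ.1).len
    rw [← hσ] at h1 h2
    have hlen := coding_len_succ (Φ := steer E G) t k
    rw [← hσ] at hlen
    have hlen' : ((coding (steer E G) t (k + 1)).1.1 : ℝ) = σ.1.1 + (steer E G σ.1).len := by
      exact_mod_cast hlen
    rw [hlen', mul_add]
    have hq : contDen a σ.1.1 = contDen σ.1.2 σ.1.1 := contDen_codeSeq t k
    change 1 ≤ contDen a _ at p0
    change 1 ≤ contDen a _ at p1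
    change contDen a _ ≤ 2 * contDen a _ * _ at h1
    change contDen a _ * _ ≤ contDen a _ at h2
    set Q := contDen a (coding (steer E G) t (k + 1)).1.1
    set q := contDen a σ.1.1
    set r := contDen ((steer E G σ.1).word σ.2) (steer E G σ.1).len with hr
    have p0' : (0 : ℝ) < Q := by exact_mod_cast p0
    have p1' : (0 : ℝ) < q := by exact_mod_cast p1
    have p2' : (0 : ℝ) < r := by exact_mod_cast p2
    have l4 : Real.log 4 = 2 * Real.log 2 := by
      rw [show (4 : ℝ) = 2 ^ 2 by norm_num, Real.log_pow]; norm_num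
    have L1 : Real.log Q ≤ Real.log 2 + Real.log q + Real.log r := by
      rw [← Real.log_mul (by norm_num) p1'.ne', ← Real.log_mul (by positivity) p2'.ne']
      exact Real.log_le_log p0' (by exact_mod_cast h1)
    have L2 : Real.log q + Real.log r ≤ Real.log Q := by
      rw [← Real.log_mul p1'.ne' p2'.ne']
      exact Real.log_le_log (by positivity) (by exact_mod_cast h2)
    by_cases hc : 2 * Real.log (contDen σ.1.2 σ.1.1) < α * σ.1.1
    · have hst : steer E G σ.1 = E := if_pos hc
      rw [hst] at hw hr ⊢
      rw [← hq] at hc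
      have e1 := hE _ hw
      rw [← hr] at e1
      have e2 : Real.log r ≤ Real.log B :=
        Real.log_le_log p2' (by exact_mod_cast hr ▸ hB _ hw)
      have e3 : 0 ≤ α * E.len := by positivity
      constructor <;> linarith
    · have hst : steer E G σ.1 = G := if_neg hc
      rw [hst] at hw hr ⊢
      rw [← hq, not_lt] at hc
      have e1 := hG _ hw
      rw [← hr] at e1
      have e2 : 0 ≤ Real.log r := Real.log_natCast_nonneg r
      constructor <;> linarith

lemma exists_abs_log_contDen_sub_le_of_forall (hα : 0 < α)
    (hE : ∀ w ∈ E.words, α * E.len ≤ 2 * Real.log (contDen w E.len))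
    (hG : ∀ w ∈ G.words, 2 * Real.log (contDen w G.len) + Real.log 4 ≤ α * G.len) :
    ∃ B : ℝ, ∀ t ∈ Ico (0 : ℝ) 1, ∀ n : ℕ,
      |2 * Real.log (contDen (codeSeq (steer E G) t) n) - α * n| ≤ B := by
  obtain ⟨B, hB⟩ := exists_abs_log_contDen_sub_le hα hE hG
  refine ⟨B + α * (E.len + G.len), fun t ht n => ?_⟩
  obtain ⟨k, hk1, hk2⟩ := exists_coding_between (Φ := steer E G) t n
  have b1 := abs_le.1 (hB t ht k)
  have b2 := abs_le.1 (hB t ht (k + 1))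
  have hmono := contDen_mono (codeSeq_one_le (Φ := steer E G) ht)
  have hpos : ∀ j, (0 : ℝ) < contDen (codeSeq (steer E G) t) j := fun j => by
    exact_mod_cast one_le_contDen (codeSeq_one_le (Φ := steer E G) ht) j
  have l1 := Real.log_le_log (hpos _) (Nat.cast_le (α := ℝ).2 (hmono hk1))
  have l2 := Real.log_le_log (hpos _) (Nat.cast_le (α := ℝ).2 (hmono hk2.le))
  have hlen : ((coding (steer E G) t (k + 1)).1.1 : ℝ) ≤
      (coding (steer E G) t k).1.1 + (E.len + G.len) := by
    have h := coding_len_succ (Φ := steer E G) t k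
    rcases steer_eq_or E G (coding (steer E G) t k).1 with e | e <;> rw [e] at h <;>
      exact_mod_cast (show _ ≤ _ by lia)
  have m1 := mul_le_mul_of_nonneg_left (Nat.cast_le (α := ℝ).2 hk1) hα.le
  have m2 := mul_le_mul_of_nonneg_left (Nat.cast_le (α := ℝ).2 hk2.le) hα.le
  have m3 := mul_le_mul_of_nonneg_left hlen hα.le
  rw [mul_add] at m3
  rw [abs_le]
  constructor <;> linarith

lemma mem_levelSet_of_abs_sub_le {a : ℕ → ℕ} {y : ℕ → ℝ} (h : IsTails a y) {B : ℝ}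
    (hB : ∀ n : ℕ, |2 * Real.log (contDen a n) - α * n| ≤ B) : y 0 ∈ levelSet (α : EReal) := by
  have hlim : Tendsto (fun n : ℕ => 2 / (n : ℝ) * Real.log (contDen a n)) atTop (𝓝 α) := by
    rw [tendsto_iff_norm_sub_tendsto_zero]
    refine squeeze_zero' (g := fun n : ℕ => B / n)
      (Eventually.of_forall fun n => norm_nonneg _) ?_
      (tendsto_const_div_atTop_nhds_zero_nat B)
    filter_upwards [eventually_ge_atTop 1] with n hn
    have hn' : (0 : ℝ) < n := by exact_mod_cast hn
    rw [Real.norm_eq_abs, show 2 / (n : ℝ) * Real.log (contDen a n) - α =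
      (2 * Real.log (contDen a n) - α * n) / n by field_simp, abs_div, abs_of_pos hn']
    gcongr
    exact hB n
  have hlim' := (continuous_coe_real_ereal.tendsto α).comp hlim
  have e : (fun n : ℕ => ((2 / (n : ℝ) * Real.log (qDen n (y 0)) : ℝ) : EReal)) =
      (fun x : ℝ => (x : EReal)) ∘ fun n : ℕ => 2 / (n : ℝ) * Real.log (contDen a n) := by
    funext n
    simp [qDen, h.cfDigit_eq]
  refine ⟨⟨h.pos 0, h.lt_one 0⟩, h.irrational, ?_, ?_⟩
  · rw [e]; exact hlim'.liminf_eq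
  · rw [e]; exact hlim'.limsup_eq

lemma one_sub_le_dimH_levelSet (hα : 0 < α) (hs0 : 0 < s) (hs1 : s < 1)
    (hE : ∀ w ∈ E.words, α * E.len ≤ 2 * Real.log (contDen w E.len))
    (hG : ∀ w ∈ G.words, 2 * Real.log (contDen w G.len) + Real.log 4 ≤ α * G.len) :
    ENNReal.ofReal (1 - s) ≤ dimH (levelSet (α : EReal)) := by
  classical
  obtain ⟨B, hB⟩ := exists_abs_log_contDen_sub_le_of_forall hα hE hG
  obtain ⟨A₁, hA₁⟩ := E.exists_digit_le
  obtain ⟨A₂, hA₂⟩ := G.exists_digit_le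
  set A := A₁ + A₂
  have hA : ∀ σ, ∀ w ∈ (steer E G σ).words, ∀ i < (steer E G σ).len, w i ≤ A := by
    intro σ
    rcases steer_eq_or E G σ with e | e <;> rw [e] <;> intro w hw i hi
    · exact (hA₁ w hw i hi).trans (Nat.le_add_right _ _)
    · exact (hA₂ w hw i hi).trans (Nat.le_add_left _ _)
  have hlen : ∀ σ, (steer E G σ).len ≤ E.len + G.len := by
    intro σ
    rcases steer_eq_or E G σ with e | e <;> rw [e] <;> lia
  set Φ := steer E G
  have hex : ∀ t : ℝ, ∃ y, t ∈ Ico (0 : ℝ) 1 → IsTails (codeSeq Φ t) y := fun t => by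
    by_cases ht : t ∈ Ico (0 : ℝ) 1
    · obtain ⟨y, hy⟩ := exists_isTails (codeSeq_one_le (Φ := Φ) ht)
      exact ⟨y, fun _ => hy⟩
    · exact ⟨fun _ => 0, fun h => absurd h ht⟩
  choose y hy using hex
  set c₀ : ℝ := (4 * ((A : ℝ) + 1) ^ 2 * (A + 2))⁻¹ * ((((A : ℝ) + 1) ^ (E.len + G.len)) ^ 2)⁻¹
  have hc₀ : 0 < c₀ := by positivity
  have hr : 0 < 1 - s := by linarith
  have hsub : (fun t => y t 0) '' Ico (0 : ℝ) 1 ⊆ levelSet (α : EReal) := by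
    rintro _ ⟨t, ht, rfl⟩
    exact mem_levelSet_of_abs_sub_le (hy t ht) (hB t ht)
  refine le_trans (le_dimH_image_of_abs_sub_le (C := Real.exp (s * B) * (c₀⁻¹) ^ (1 - s)) hr ?_)
    (dimH_mono hsub)
  intro t ht t' ht'
  have hqpos : ∀ j, (0 : ℝ) < contDen (codeSeq Φ t) j := fun j => by
    exact_mod_cast one_le_contDen (codeSeq_one_le (Φ := Φ) ht) j
  -- the distance of two parameters with a common prefix
  have key : ∀ k, (coding Φ t k).1 = (coding Φ t' k).1 →
      (∀ j < k, (coding Φ t j).1 = (coding Φ t' j).1 ∧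
        (Φ (coding Φ t j).1).word (coding Φ t j).2 =
          (Φ (coding Φ t j).1).word (coding Φ t' j).2) →
      |t - t'| ≤ Real.exp (s * B) *
        (((contDen (codeSeq Φ t) (coding Φ t k).1.1 : ℝ) ^ 2)⁻¹) ^ (1 - s) := by
    intro k hk hk'
    have h1 := abs_sub_le_of_coding_eq ht ht' k hk hk'
    have i1 := coding_snd_mem (Φ := Φ) ht k
    have i2 := coding_snd_mem (Φ := Φ) ht' k
    have h2 : |(coding Φ t k).2 - (coding Φ t' k).2| ≤ 1 := by
      rw [abs_le]
      constructor <;> linarith [i1.1, i1.2, i2.1, i2.2]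
    have h3 := (abs_le.1 (hB t ht (coding Φ t k).1.1)).1
    have hq := hqpos (coding Φ t k).1.1
    set q : ℝ := ((contDen (codeSeq Φ t) (coding Φ t k).1.1 : ℕ) : ℝ)
    have e : (q ^ 2)⁻¹ = Real.exp (-(2 * Real.log q)) := by
      rw [Real.exp_neg, mul_comm, Real.exp_mul, Real.exp_log hq]
      norm_num
    refine h1.trans ((mul_le_of_le_one_right (by positivity) h2).trans ?_)
    rw [e, ← Real.exp_mul, ← Real.exp_add, ← Real.exp_add, Real.exp_le_exp]
    nlinarith
  by_cases hall : ∀ k, (coding Φ t k).1 = (coding Φ t' k).1 ∧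
        (Φ (coding Φ t k).1).word (coding Φ t k).2 =
          (Φ (coding Φ t k).1).word (coding Φ t' k).2
  · have hlim : Tendsto (fun k => Real.exp (s * B) *
        (((contDen (codeSeq Φ t) (coding Φ t k).1.1 : ℝ) ^ 2)⁻¹) ^ (1 - s)) atTop (𝓝 0) := by
      have hq : Tendsto (fun n => (contDen (codeSeq Φ t) n : ℝ)) atTop atTop := by
        have h1 : Tendsto (fun n : ℕ => (α * n - B) / 2) atTop atTop :=
          (tendsto_atTop_add_const_right _ _
            (tendsto_natCast_atTop_atTop.const_mul_atTop hα)).atTop_div_const two_pos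
        refine tendsto_atTop_mono (fun n => ?_) h1
        have h2 := (abs_le.1 (hB t ht n)).1
        have h3 := Real.log_le_sub_one_of_pos (hqpos n)
        linarith
      have hq2 := (tendsto_inv_atTop_zero.comp ((tendsto_pow_atTop two_ne_zero).comp
        (hq.comp (coding_len_strictMono (Φ := Φ) t).tendsto_atTop)))
      have := (hq2.rpow_const (p := 1 - s) (Or.inr hr.le)).const_mul (Real.exp (s * B))
      rw [Real.zero_rpow hr.ne', mul_zero] at this
      exact this
    have h0 : |t - t'| ≤ 0 :=
      ge_of_tendsto' hlim fun k => key k (hall k).1 fun j _ => hall j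
    exact h0.trans (by positivity)
  · have hexk : ∃ k, ¬((coding Φ t k).1 = (coding Φ t' k).1 ∧
        (Φ (coding Φ t k).1).word (coding Φ t k).2 =
          (Φ (coding Φ t k).1).word (coding Φ t' k).2) := not_forall.1 hall
    set k := Nat.find hexk
    have hk := Nat.find_spec hexk
    have hlt : ∀ j < k, _ := fun j hj => not_not.1 (Nat.find_min hexk hj)
    change ¬((coding Φ t k).1 = (coding Φ t' k).1 ∧
        (Φ (coding Φ t k).1).word (coding Φ t k).2 =
          (Φ (coding Φ t k).1).word (coding Φ t' k).2) at hk
    have heq : (coding Φ t k).1 = (coding Φ t' k).1 := by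
      rcases Nat.eq_zero_or_pos k with h | h
      · rw [h]; rfl
      · obtain ⟨j, hj⟩ := Nat.exists_eq_succ_of_ne_zero h.ne'
        obtain ⟨e1, e2⟩ := hlt j (by lia)
        rw [hj, Nat.succ_eq_add_one, coding_succ, coding_succ, appendWord, appendWord]
        rw [← e1, e2]
    have hne : (Φ (coding Φ t k).1).word (coding Φ t k).2 ≠
        (Φ (coding Φ t k).1).word (coding Φ t' k).2 := fun h => hk ⟨heq, h⟩
    have h1 := key k heq hlt
    -- the first digit at which the two sequences differ
    have hdiff : ∃ i, codeSeq Φ t i ≠ codeSeq Φ t' i ∧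
        i < (coding Φ t k).1.1 + (E.len + G.len) := by
      by_contra! hcon
      refine hne ((Φ (coding Φ t k).1).ext_words _
        ((Φ (coding Φ t k).1).word_mem (coding_snd_mem ht k)) _
        ((Φ (coding Φ t k).1).word_mem (coding_snd_mem ht' k)) fun i hi => ?_)
      have hL := hlen (coding Φ t k).1
      have e1 := codeSeq_add (Φ := Φ) (t := t) hi
      have e2 := codeSeq_add (Φ := Φ) (t := t') (k := k) (i := i) (heq ▸ hi)
      rw [← heq] at e2
      rw [← e1, ← e2]
      by_contra hn
      exact absurd (hcon _ hn) (by lia)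
    set i := Nat.find hdiff
    obtain ⟨hi1, hi2⟩ := Nat.find_spec hdiff
    have hmin : ∀ j < i, codeSeq Φ t j = codeSeq Φ t' j := fun j hj => by
      by_contra hn
      exact Nat.find_min hdiff hj ⟨hn, (hj.trans hi2)⟩
    have h2 := (hy t ht).le_abs_sub (hy t' ht') (codeSeq_le hA ht) (codeSeq_le hA ht') hmin hi1
    have h3 : contDen (codeSeq Φ t) i ≤
        (A + 1) ^ (E.len + G.len) * contDen (codeSeq Φ t) (coding Φ t k).1.1 :=
      (contDen_mono (codeSeq_one_le ht) hi2.le).trans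
        (contDen_add_le_pow (codeSeq_one_le ht) (codeSeq_le hA ht) _ _)
    have h3' : (contDen (codeSeq Φ t) i : ℝ) ≤
        ((A : ℝ) + 1) ^ (E.len + G.len) * contDen (codeSeq Φ t) (coding Φ t k).1.1 := by
      exact_mod_cast h3
    have hq := hqpos (coding Φ t k).1.1
    have hqi := hqpos i
    set q : ℝ := ((contDen (codeSeq Φ t) (coding Φ t k).1.1 : ℕ) : ℝ)
    have h4 : c₀ * (q ^ 2)⁻¹ ≤ |y t 0 - y t' 0| := by
      refine le_trans ?_ h2
      rw [mul_assoc, ← mul_inv, ← mul_pow]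
      gcongr
    have h5 : (q ^ 2)⁻¹ ≤ c₀⁻¹ * |y t 0 - y t' 0| := by
      rw [← div_eq_inv_mul, le_div_iff₀ hc₀, mul_comm]
      exact h4
    calc |t - t'| ≤ _ := h1
      _ ≤ Real.exp (s * B) * (c₀⁻¹ * |y t 0 - y t' 0|) ^ (1 - s) := by gcongr
      _ = _ := by rw [Real.mul_rpow (by positivity) (abs_nonneg _), mul_assoc]

end Steering

/-! ### The Gauss measure -/

/-- The (unnormalized) Gauss measure, with density `1 / (1 + x)` on `(0, 1)`. -/
noncomputable def gaussMeasure : Measure ℝ :=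
  (volume.restrict (Ioo 0 1)).withDensity fun x => ENNReal.ofReal (1 / (1 + x))

lemma measurable_gaussMap : Measurable gaussMap :=
  measurable_fract.comp (measurable_const.div measurable_id)

lemma measurable_gaussDensity : Measurable fun x : ℝ => ENNReal.ofReal (1 / (1 + x)) := by
  fun_prop

lemma lintegral_gaussMeasure {f : ℝ → ENNReal} (hf : Measurable f) :
    ∫⁻ x, f x ∂gaussMeasure = ∫⁻ x in Ico 0 1, ENNReal.ofReal (1 / (1 + x)) * f x := by
  rw [gaussMeasure, lintegral_withDensity_eq_lintegral_mul _ measurable_gaussDensity hf,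
    Measure.restrict_congr_set Ioo_ae_eq_Ico]
  rfl

lemma hasSum_gaussDensity {y : ℝ} (hy : 0 ≤ y) :
    HasSum (fun k : ℕ => 1 / ((k + 1 + y) * (k + 2 + y))) (1 / (1 + y)) := by
  rw [hasSum_iff_tendsto_nat_of_nonneg (fun k => by positivity)]
  have e : ∀ n : ℕ, ∑ k ∈ Finset.range n, 1 / (((k : ℝ) + 1 + y) * (k + 2 + y)) =
      1 / (1 + y) - 1 / ((n : ℝ) + (1 + y)) := by
    intro n
    induction n with
    | zero => simp
    | succ n ih =>
      rw [Finset.sum_range_succ, ih]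
      have h1 : (n : ℝ) + 1 + y ≠ 0 := by positivity
      have h2 : (n : ℝ) + 2 + y ≠ 0 := by positivity
      have h3 : (n : ℝ) + (1 + y) ≠ 0 := by positivity
      have h4 : ((n : ℝ) + 1) + (1 + y) ≠ 0 := by positivity
      push_cast
      have h5 : 1 + y ≠ 0 := by positivity
      rw [show (n : ℝ) + 1 + (1 + y) = n + 2 + y by ring,
        show (n : ℝ) + (1 + y) = n + 1 + y by ring]
      field_simp
      ring
  simp_rw [e]
  have h := (tendsto_natCast_atTop_atTop (R := ℝ)).atTop_add
    (tendsto_const_nhds (x := 1 + y))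
  have := (tendsto_inv_atTop_zero.comp h).const_sub (1 / (1 + y))
  simpa [Function.comp_def] using this

lemma lintegral_comp_gaussMap_le {f : ℝ → ENNReal} (hf : Measurable f) :
    ∫⁻ x, f (gaussMap x) ∂gaussMeasure ≤ ∫⁻ x, f x ∂gaussMeasure := by
  rw [lintegral_gaussMeasure (f := fun x => f (gaussMap x)) (hf.comp measurable_gaussMap),
    Measure.restrict_congr_set Ico_ae_eq_Ioc, lintegral_gaussMeasure hf]
  set g : ℕ → ℝ → ℝ := fun k y => (k + 1 + y)⁻¹
  have hcover : Ioc (0 : ℝ) 1 ⊆ ⋃ k, g k '' Ico 0 1 := by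
    intro x hx
    rw [mem_iUnion]
    have h1 : 1 ≤ 1 / x := by rw [le_div_iff₀ hx.1]; linarith [hx.2]
    have h2 : 1 ≤ ⌊1 / x⌋₊ := by rwa [Nat.one_le_floor_iff]
    have h3 : 0 ≤ 1 / x := by linarith
    refine ⟨⌊1 / x⌋₊ - 1, Int.fract (1 / x), ⟨Int.fract_nonneg _, Int.fract_lt_one _⟩, ?_⟩
    simp only [g]
    rw [Nat.cast_sub h2, Nat.cast_one, sub_add_cancel, natCast_floor_eq_intCast_floor h3,
      Int.floor_add_fract, one_div, inv_inv]
  refine (lintegral_mono_set hcover).trans ((lintegral_iUnion_le _ _).trans ?_)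
  have hderiv : ∀ k : ℕ, ∀ y ∈ Ico (0 : ℝ) 1,
      HasDerivWithinAt (g k) (-1 / (k + 1 + y) ^ 2) (Ico 0 1) y := by
    intro k y hy
    have h0 : (k : ℝ) + 1 + y ≠ 0 := by have := hy.1; positivity
    exact (((hasDerivAt_id y).const_add ((k : ℝ) + 1)).inv h0).hasDerivWithinAt
  have hinj : ∀ k : ℕ, InjOn (g k) (Ico 0 1) := by
    intro k y _ z _ h
    have := inv_injective h
    linarith
  have hterm : ∀ k : ℕ, ∫⁻ x in g k '' Ico 0 1, ENNReal.ofReal (1 / (1 + x)) * f (gaussMap x) =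
      ∫⁻ y in Ico 0 1, ENNReal.ofReal (1 / ((k + 1 + y) * (k + 2 + y))) * f y := by
    intro k
    rw [lintegral_image_eq_lintegral_abs_deriv_mul measurableSet_Ico (hderiv k) (hinj k)]
    refine setLIntegral_congr_fun measurableSet_Ico fun y hy => ?_
    have hy0 := hy.1
    have h0 : (0 : ℝ) < (k : ℝ) + 1 + y := by positivity
    have e1 : gaussMap (g k y) = y := by
      rw [gaussMap, one_div, inv_inv,
        show (k : ℝ) + 1 + y = ((k + 1 : ℕ) : ℝ) + y by push_cast; ring,
        Int.fract_natCast_add, Int.fract_eq_self.2 hy]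
    simp only [e1]
    rw [← mul_assoc, ← ENNReal.ofReal_mul (abs_nonneg _)]
    congr 2
    rw [abs_div, abs_neg, abs_one, abs_of_pos (by positivity)]
    simp only [g]
    field_simp
    ring
  simp_rw [hterm]
  rw [← lintegral_tsum fun k => by fun_prop]
  refine le_of_eq (setLIntegral_congr_fun measurableSet_Ico fun y hy => ?_)
  have h := hasSum_gaussDensity hy.1
  have hy0 := hy.1
  rw [ENNReal.tsum_mul_right,
    ← ENNReal.ofReal_tsum_of_nonneg (fun k => by positivity) h.summable, h.tsum_eq]

lemma lintegral_comp_iterate_gaussMap_le (n : ℕ) : ∀ {f : ℝ → ENNReal}, Measurable f →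
    ∫⁻ x, f (gaussMap^[n] x) ∂gaussMeasure ≤ ∫⁻ x, f x ∂gaussMeasure := by
  induction n with
  | zero => exact fun _ => le_rfl
  | succ n ih =>
    intro f hf
    simp only [Function.iterate_succ_apply']
    exact (ih (hf.comp measurable_gaussMap)).trans (lintegral_comp_gaussMap_le hf)

lemma intervalIntegrable_pow_mul_neg_log (k : ℕ) :
    IntervalIntegrable (fun x : ℝ => x ^ k * -Real.log x) volume 0 1 :=
  (intervalIntegral.intervalIntegrable_log'.neg).continuousOn_mul (by fun_prop)

lemma integral_pow_mul_neg_log (k : ℕ) :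
    ∫ x in (0 : ℝ)..1, x ^ k * -Real.log x = 1 / ((k : ℝ) + 1) ^ 2 := by
  have hk : (k : ℝ) + 1 ≠ 0 := by positivity
  set F : ℝ → ℝ := fun x =>
    x ^ (k + 1) / ((k : ℝ) + 1) ^ 2 - x ^ k * (x * Real.log x) / ((k : ℝ) + 1)
  have hF : ContinuousOn F (Icc 0 1) := by
    have := Real.continuous_mul_log
    exact Continuous.continuousOn (by fun_prop)
  rw [intervalIntegral.integral_eq_sub_of_hasDerivAt_of_le zero_le_one hF (fun x hx => ?_)
    (intervalIntegrable_pow_mul_neg_log k)]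
  · simp [F]
  · have h0 := hx.1.ne'
    have e : F = fun x =>
        x ^ (k + 1) / ((k : ℝ) + 1) ^ 2 - x ^ (k + 1) * Real.log x / ((k : ℝ) + 1) := by
      funext x; simp only [F]; ring
    rw [e]
    refine (((hasDerivAt_pow (k + 1) x).div_const (((k : ℝ) + 1) ^ 2)).sub
      (((hasDerivAt_pow (k + 1) x).mul (Real.hasDerivAt_log h0)).div_const
        ((k : ℝ) + 1))).congr_deriv ?_
    rw [Nat.add_sub_cancel]
    push_cast
    field_simp
    ring

lemma alternating_sum_eq (K : ℕ) :
    ∑ k ∈ Finset.range (2 * K + 1), (-1 : ℝ) ^ k * (1 / ((k : ℝ) + 1) ^ 2) =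
      ∑ m ∈ Finset.range (2 * K + 2), 1 / (m : ℝ) ^ 2 -
        1 / 2 * ∑ m ∈ Finset.range (K + 1), 1 / (m : ℝ) ^ 2 := by
  induction K with
  | zero => norm_num [Finset.sum_range_succ]
  | succ K ih =>
    rw [show 2 * (K + 1) + 1 = 2 * K + 1 + 1 + 1 by ring, Finset.sum_range_succ,
      Finset.sum_range_succ, ih, show 2 * (K + 1) + 2 = 2 * K + 2 + 1 + 1 by ring,
      Finset.sum_range_succ _ (2 * K + 2 + 1), Finset.sum_range_succ _ (2 * K + 2),
      Finset.sum_range_succ _ (K + 1)]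
    have e1 : (-1 : ℝ) ^ (2 * K + 1) = -1 := Odd.neg_one_pow ⟨K, rfl⟩
    have e2 : (-1 : ℝ) ^ (2 * K + 1 + 1) = 1 := Even.neg_one_pow ⟨K + 1, by ring⟩
    rw [e1, e2]
    push_cast
    have h1 : (K : ℝ) + 1 ≠ 0 := by positivity
    have h2 : (2 : ℝ) * (K + 1) + 1 ≠ 0 := by positivity
    rw [show (2 : ℝ) * K + 1 + 1 = 2 * (K + 1) by ring,
      show (2 : ℝ) * K + 2 = 2 * (K + 1) by ring]
    field_simp
    ring

lemma one_div_one_add_le_sum {x : ℝ} (hx : 0 ≤ x) (K : ℕ) :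
    1 / (1 + x) ≤ ∑ k ∈ Finset.range (2 * K + 1), (-1 : ℝ) ^ k * x ^ k := by
  have h : ∑ k ∈ Finset.range (2 * K + 1), (-1 : ℝ) ^ k * x ^ k =
      (1 + x ^ (2 * K + 1)) / (1 + x) := by
    have := geom_sum_eq (x := -x) (by linarith) (2 * K + 1)
    simp_rw [← mul_pow, neg_one_mul]
    rw [this, Odd.neg_pow ⟨K, rfl⟩, ← neg_div_neg_eq]
    ring_nf
  rw [h]
  have : 0 ≤ x ^ (2 * K + 1) := by positivity
  gcongr
  linarith

lemma lintegral_neg_log_le :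
    ∫⁻ x, ENNReal.ofReal (-Real.log x) ∂gaussMeasure ≤ ENNReal.ofReal (Real.pi ^ 2 / 12) := by
  have hpart : ∀ K : ℕ, ∫⁻ x, ENNReal.ofReal (-Real.log x) ∂gaussMeasure ≤
      ENNReal.ofReal
        (∑ k ∈ Finset.range (2 * K + 1), (-1 : ℝ) ^ k * (1 / ((k : ℝ) + 1) ^ 2)) := by
    intro K
    have hi : ∀ k ∈ Finset.range (2 * K + 1), IntervalIntegrable
        (fun x : ℝ => (-1) ^ k * (x ^ k * -Real.log x)) volume 0 1 :=
      fun k _ => (intervalIntegrable_pow_mul_neg_log k).const_mul _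
    have hle : ∀ x ∈ Ioc (0 : ℝ) 1, 1 / (1 + x) * -Real.log x ≤
        ∑ k ∈ Finset.range (2 * K + 1), (-1 : ℝ) ^ k * (x ^ k * -Real.log x) := by
      intro x hx
      simp_rw [← mul_assoc]
      rw [← Finset.sum_mul]
      refine mul_le_mul_of_nonneg_right (one_div_one_add_le_sum hx.1.le K) ?_
      linarith [Real.log_nonpos hx.1.le hx.2]
    have hnn : ∀ x ∈ Ioc (0 : ℝ) 1, 0 ≤
        ∑ k ∈ Finset.range (2 * K + 1), (-1 : ℝ) ^ k * (x ^ k * -Real.log x) := fun x hx =>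
      le_trans (mul_nonneg (by have := hx.1; positivity)
        (by linarith [Real.log_nonpos hx.1.le hx.2])) (hle x hx)
    simp_rw [← integral_pow_mul_neg_log, ← intervalIntegral.integral_const_mul]
    rw [← intervalIntegral.integral_finsetSum hi, lintegral_gaussMeasure (by fun_prop),
      Measure.restrict_congr_set Ico_ae_eq_Ioc, intervalIntegral.integral_of_le zero_le_one,
      ofReal_integral_eq_lintegral_ofReal]
    · refine setLIntegral_mono' measurableSet_Ioc fun x hx => ?_
      have := hx.1
      rw [← ENNReal.ofReal_mul (by positivity)]
      exact ENNReal.ofReal_le_ofReal (hle x hx)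
    · have := IntervalIntegrable.sum _ hi
      rw [intervalIntegrable_iff_integrableOn_Ioc_of_le zero_le_one, Finset.sum_fn] at this
      exact this
    · rw [EventuallyLE, ae_restrict_iff' measurableSet_Ioc]
      exact Eventually.of_forall hnn
  have hlim : Tendsto (fun K : ℕ => ∑ k ∈ Finset.range (2 * K + 1),
      (-1 : ℝ) ^ k * (1 / ((k : ℝ) + 1) ^ 2)) atTop (𝓝 (Real.pi ^ 2 / 12)) := by
    simp_rw [alternating_sum_eq]
    have hz := hasSum_zeta_two.tendsto_sum_nat
    have h1 := hz.comp (tendsto_atTop_mono (fun K : ℕ => show K ≤ 2 * K + 2 by lia) tendsto_id)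
    have h2 := hz.comp (tendsto_add_atTop_nat 1)
    have h3 := h1.sub (h2.const_mul (1 / 2))
    rw [show Real.pi ^ 2 / 6 - 1 / 2 * (Real.pi ^ 2 / 6) = Real.pi ^ 2 / 12 by ring] at h3
    exact h3
  exact ge_of_tendsto' (ENNReal.tendsto_ofReal hlim) hpart

lemma le_gaussMeasure_Ioo : ENNReal.ofReal (Real.log 2) ≤ gaussMeasure (Ioo 0 1) := by
  have hc : ContinuousOn (fun x : ℝ => 1 / (1 + x)) (uIcc 0 1) := by
    rw [uIcc_of_le zero_le_one]
    exact continuousOn_const.div (by fun_prop) fun x hx => by linarith [hx.1]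
  have hi : ∫ x in (0 : ℝ)..1, 1 / (1 + x) = Real.log 2 := by
    rw [intervalIntegral.integral_eq_sub_of_hasDerivAt (f := fun x => Real.log (1 + x))
      (fun x hx => ?_) hc.intervalIntegrable]
    · norm_num
    · rw [uIcc_of_le zero_le_one] at hx
      exact ((hasDerivAt_id x).const_add 1).log (by simp only [id]; linarith [hx.1])
  rw [gaussMeasure, withDensity_apply _ measurableSet_Ioo, Measure.restrict_restrict
    measurableSet_Ioo, inter_self, Measure.restrict_congr_set Ioo_ae_eq_Ioc, ← hi,
    intervalIntegral.integral_of_le zero_le_one, ofReal_integral_eq_lintegral_ofReal]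
  · exact (intervalIntegrable_iff_integrableOn_Ioc_of_le zero_le_one).1 hc.intervalIntegrable
  · rw [EventuallyLE, ae_restrict_iff' measurableSet_Ioc]
    exact Eventually.of_forall fun x hx => by
      have := hx.1
      simp only [Pi.zero_apply]
      positivity

lemma gaussMeasure_le_volume (S : Set ℝ) : gaussMeasure S ≤ volume S := by
  have h1 : gaussMeasure ≤ (volume.restrict (Ioo (0 : ℝ) 1)).withDensity 1 := by
    refine withDensity_mono ?_
    rw [EventuallyLE, ae_restrict_iff' measurableSet_Ioo]
    refine Eventually.of_forall fun x hx => ?_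
    rw [Pi.one_apply, ← ENNReal.ofReal_one]
    refine ENNReal.ofReal_le_ofReal ?_
    rw [div_le_one (by linarith [hx.1])]
    linarith [hx.1]
  rw [withDensity_one] at h1
  exact (h1 S).trans (Measure.restrict_apply_le _ _)

lemma gaussMeasure_setOf_not_irrational : gaussMeasure {x : ℝ | ¬ Irrational x} = 0 := by
  refine le_antisymm ((gaussMeasure_le_volume _).trans (le_of_eq ?_)) zero_le
  refine Countable.measure_zero ?_ _
  simp only [Irrational, not_not]
  exact countable_range _

/-- The irrational numbers in `(0, 1)` whose `n`-th denominator is at most `e ^ b`. -/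
def smallDen (n : ℕ) (b : ℝ) : Set ℝ :=
  {x | x ∈ Ioo (0 : ℝ) 1 ∧ Irrational x ∧ Real.log (qDen n x) ≤ b}

lemma log_qDen_le {x : ℝ} (hx : x ∈ Ioo (0 : ℝ) 1) (hx' : Irrational x) (n : ℕ) :
    Real.log (qDen n x) ≤ ∑ i ∈ Finset.range n, -Real.log (gaussMap^[i] x) := by
  have h := isTails_cfDigit hx hx'
  have h1 := h.contDen_mul_prod_le n
  have h2 := h.prod_pos n
  have h3 := h.contDen_pos n
  have h4 := Real.log_nonpos (by positivity) h1
  rw [Real.log_mul h3.ne' h2.ne', Real.log_prod fun i _ => (h.pos i).ne'] at h4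
  rw [Finset.sum_neg_distrib, qDen]
  linarith

lemma le_volume_smallDen_add (n : ℕ) {b : ℝ} (hb : 0 < b) :
    ENNReal.ofReal (Real.log 2) ≤
      volume (smallDen n b) + ENNReal.ofReal (n * (Real.pi ^ 2 / 12) / b) := by
  set S : ℝ → ENNReal := fun x =>
    ∑ i ∈ Finset.range n, ENNReal.ofReal (-Real.log (gaussMap^[i] x))
  have hm : ∀ i : ℕ, Measurable fun x => ENNReal.ofReal (-Real.log (gaussMap^[i] x)) := fun i =>
    (Real.measurable_log.comp (measurable_gaussMap.iterate i)).neg.ennreal_ofReal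
  have hS : ∫⁻ x, S x ∂gaussMeasure ≤ ENNReal.ofReal (n * (Real.pi ^ 2 / 12)) := by
    rw [lintegral_finsetSum _ fun i _ => hm i, ENNReal.ofReal_mul (by positivity),
      ENNReal.ofReal_natCast]
    refine (Finset.sum_le_card_nsmul _ _ _ fun i _ =>
      (lintegral_comp_iterate_gaussMap_le i (f := fun x => ENNReal.ofReal (-Real.log x))
        (by fun_prop)).trans lintegral_neg_log_le).trans ?_
    simp
  have hbad : gaussMeasure {x | ENNReal.ofReal b ≤ S x} ≤
      ENNReal.ofReal (n * (Real.pi ^ 2 / 12) / b) := by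
    rw [ENNReal.ofReal_div_of_pos hb]
    rw [ENNReal.le_div_iff_mul_le (Or.inl (by simpa using hb)) (Or.inl ENNReal.ofReal_ne_top),
      mul_comm]
    exact (mul_meas_ge_le_lintegral (Finset.measurable_fun_sum _ fun i _ => hm i) _).trans hS
  have hcover : Ioo (0 : ℝ) 1 ⊆
      (smallDen n b ∪ {x | ENNReal.ofReal b ≤ S x}) ∪ {x | ¬ Irrational x} := by
    intro x hx
    by_cases hx' : Irrational x
    · left
      by_cases hl : Real.log (qDen n x) ≤ b
      · exact Or.inl ⟨hx, hx', hl⟩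
      · right
        have h := log_qDen_le hx hx' n
        simp only [mem_ofPred_eq, S]
        rw [← ENNReal.ofReal_sum_of_nonneg]
        · exact ENNReal.ofReal_le_ofReal (by linarith)
        · intro i _
          have := (iterate_gaussMap_mem hx hx' i).1
          linarith [Real.log_nonpos this.1.le this.2.le]
    · exact Or.inr hx'
  calc ENNReal.ofReal (Real.log 2) ≤ gaussMeasure (Ioo 0 1) := le_gaussMeasure_Ioo
    _ ≤ _ := measure_mono hcover
    _ ≤ _ := measure_union_le _ _
    _ = gaussMeasure (smallDen n b ∪ {x | ENNReal.ofReal b ≤ S x}) := by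
      rw [gaussMeasure_setOf_not_irrational, add_zero]
    _ ≤ _ := measure_union_le _ _
    _ ≤ _ := add_le_add (gaussMeasure_le_volume _) hbad

/-! ### Word families from lower bounds on measures -/

/-- The sequence that starts with the word `v` and continues with ones. -/
def extendByOne {l : ℕ} (v : Fin l → ℕ) (i : ℕ) : ℕ := if h : i < l then v ⟨i, h⟩ else 1

lemma extendByOne_apply {l : ℕ} (v : Fin l → ℕ) (i : Fin l) : extendByOne v i = v i := by
  simp [extendByOne]

lemma extendByOne_injective {l : ℕ} : Function.Injective (extendByOne (l := l)) := by
  intro v v' h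
  ext i
  rw [← extendByOne_apply v, h, extendByOne_apply]

lemma volume_setOf_cfDigit_eq_le (a : ℕ → ℕ) (l : ℕ) :
    volume {x : ℝ | x ∈ Ioo (0 : ℝ) 1 ∧ Irrational x ∧ ∀ i < l, cfDigit x i = a i} ≤
      ENNReal.ofReal (((contDen a l : ℝ) ^ 2)⁻¹) := by
  refine (Real.volume_le_diam _).trans (Metric.ediam_le ?_)
  rintro x ⟨hx, hx', hxa⟩ z ⟨hz, hz', hza⟩
  have h := (isTails_cfDigit hx hx').abs_sub_le (isTails_cfDigit hz hz') l
    fun i hi => (hxa i hi).trans (hza i hi).symm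
  rw [contDen_congr l hxa] at h
  rw [edist_dist, Real.dist_eq]
  exact ENNReal.ofReal_le_ofReal h

lemma exists_wordFamily {c : ℝ} {l : ℕ} (hl : 0 < l) (P : ℕ → Prop)
    (h : ENNReal.ofReal (4 * Real.exp (-(c * l))) <
      volume {x : ℝ | x ∈ Ioo (0 : ℝ) 1 ∧ Irrational x ∧ P (qDen l x)}) :
    ∃ E : WordFamily c, E.len = l ∧ ∀ w ∈ E.words, P (contDen w E.len) := by
  classical
  set S : Set ℝ := {x | x ∈ Ioo (0 : ℝ) 1 ∧ Irrational x ∧ P (qDen l x)}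
  set cyl : (Fin l → ℕ) → Set ℝ := fun v => {x ∈ S | ∀ i < l, cfDigit x i = extendByOne v i}
  have hcover : S ⊆ ⋃ v, cyl v := fun x hx => mem_iUnion.2
    ⟨fun i => cfDigit x i, hx, fun i hi => (extendByOne_apply (fun i => cfDigit x i) ⟨i, hi⟩).symm⟩
  have hlt := h.trans_le ((measure_mono hcover).trans (measure_iUnion_le _))
  rw [ENNReal.tsum_eq_iSup_sum, lt_iSup_iff] at hlt
  obtain ⟨F, hF⟩ := hlt
  have hmem : ∀ w ∈ (F.filter fun v => (cyl v).Nonempty).image extendByOne,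
      (∀ i, 1 ≤ w i) ∧ P (contDen w l) ∧ ∃ v : Fin l → ℕ, extendByOne v = w := by
    intro w hw
    obtain ⟨v, hv, rfl⟩ := Finset.mem_image.1 hw
    obtain ⟨x, ⟨hx, hx', hP⟩, hxv⟩ := (Finset.mem_filter.1 hv).2
    refine ⟨fun i => ?_, contDen_congr l hxv ▸ hP, v, rfl⟩
    by_cases hi : i < l
    · exact hxv i hi ▸ (isTails_cfDigit hx hx').one_le i
    · simp [extendByOne, hi]
  refine ⟨⟨l, (F.filter fun v => (cyl v).Nonempty).image extendByOne, hl,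
    fun w hw => (hmem w hw).1, fun w hw w' hw' e => ?_, ?_⟩, rfl, fun w hw => (hmem w hw).2.1⟩
  · obtain ⟨v, rfl⟩ := (hmem w hw).2.2
    obtain ⟨v', rfl⟩ := (hmem w' hw').2.2
    congr 1
    ext i
    rw [← extendByOne_apply v, e i i.2, extendByOne_apply]
  · rw [Finset.sum_image extendByOne_injective.injOn]
    rw [← ENNReal.ofReal_le_ofReal_iff (by positivity),
      ENNReal.ofReal_sum_of_nonneg fun _ _ => by positivity]
    refine hF.le.trans ?_
    rw [Finset.sum_filter]
    refine Finset.sum_le_sum fun v _ => ?_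
    split_ifs with hv
    · refine (measure_mono ?_).trans (volume_setOf_cfDigit_eq_le (extendByOne v) l)
      exact fun x hx => ⟨hx.1.1, hx.1.2.1, hx.2⟩
    · rw [not_nonempty_iff_eq_empty.1 hv, measure_empty]

/-! ### The upper tail -/

lemma levyConst_pos : 0 < levyConst := by
  have := Real.log_pos one_lt_two
  have := Real.pi_pos
  rw [levyConst]
  positivity

lemma exists_small_wordFamily {α c : ℝ} (hα : 2 * levyConst < α) (hc : 0 < c) :
    ∃ G : WordFamily c, ∀ w ∈ G.words,
      2 * Real.log (contDen w G.len) + Real.log 4 ≤ α * G.len := by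
  have hα0 : 0 < α := by linarith [levyConst_pos]
  have hl2 := Real.log_pos one_lt_two
  set b : ℕ → ℝ := fun N => (α * N - Real.log 4) / 2
  suffices h : ∃ N : ℕ, 0 < N ∧ ENNReal.ofReal (4 * Real.exp (-(c * N))) <
      volume (smallDen N (b N)) by
    obtain ⟨N, hN, hlt⟩ := h
    obtain ⟨G, hG, hP⟩ := exists_wordFamily hN (fun q => Real.log q ≤ b N) hlt
    refine ⟨G, fun w hw => ?_⟩
    have := hP w hw
    simp only [b] at this
    rw [hG] at this ⊢
    linarith
  by_contra! hcon
  have hN := tendsto_natCast_atTop_atTop (R := ℝ)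
  have hb : ∀ᶠ N : ℕ in atTop, 0 < b N := by
    filter_upwards [(hN.const_mul_atTop hα0).eventually_gt_atTop (Real.log 4)] with N h
    exact half_pos (sub_pos.2 h)
  have hle : ∀ᶠ N : ℕ in atTop, Real.log 2 ≤
      4 * Real.exp (-(c * N)) + Real.pi ^ 2 / 12 / ((α - Real.log 4 / N) / 2) := by
    filter_upwards [hb, eventually_gt_atTop 0] with N hbN hN0
    have h1 := (le_volume_smallDen_add N hbN).trans (add_le_add_left (hcon N hN0) _)
    rw [← ENNReal.ofReal_add (by positivity) (by positivity),
      ENNReal.ofReal_le_ofReal_iff (by positivity)] at h1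
    have hN1 : (N : ℝ) ≠ 0 := by positivity
    have e : (α - Real.log 4 / N) / 2 = b N / N := by
      simp only [b]
      field_simp
    rwa [e, div_div_eq_mul_div, mul_comm (Real.pi ^ 2 / 12)]
  have hlim : Tendsto (fun N : ℕ => 4 * Real.exp (-(c * N)) +
      Real.pi ^ 2 / 12 / ((α - Real.log 4 / N) / 2)) atTop
      (𝓝 (4 * 0 + Real.pi ^ 2 / 12 / ((α - 0) / 2))) := by
    refine ((Real.tendsto_exp_neg_atTop_nhds_zero.comp (hN.const_mul_atTop hc)).const_mul 4).add
      (Tendsto.div tendsto_const_nhds ?_ (by simpa using hα0.ne'))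
    exact ((hN.const_div_atTop _).const_sub _).div_const 2
  have h := ge_of_tendsto hlim hle
  rw [mul_zero, zero_add, sub_zero, le_div_iff₀ (half_pos hα0)] at h
  rw [levyConst, mul_div_assoc', div_lt_iff₀ (by positivity)] at hα
  linarith

lemma one_sub_le_dimSpec {n : ℕ} (hn : 1 ≤ n) {α s : ℝ} (hα : 2 * levyConst < α) (hs : 0 < s)
    (h : ENNReal.ofReal (4 * Real.exp (-(s * α * n))) < volume {x : ℝ | x ∈ Ioo (0 : ℝ) 1 ∧
      Irrational x ∧ α ≤ 2 / (n : ℝ) * Real.log (qDen n x)}) : 1 - s ≤ dimSpec α := by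
  have hα0 : 0 < α := by linarith [levyConst_pos]
  rcases le_or_gt 1 s with hs1 | hs1
  · exact (sub_nonpos.2 hs1).trans ENNReal.toReal_nonneg
  obtain ⟨E, hE, hP⟩ := exists_wordFamily hn (fun q => α ≤ 2 / (n : ℝ) * Real.log q) h
  obtain ⟨G, hG⟩ := exists_small_wordFamily hα (mul_pos hs hα0)
  have hn0 : (0 : ℝ) < n := by positivity
  have hdim := one_sub_le_dimH_levelSet hα0 hs hs1 (E := E) (G := G) (fun w hw => by
    have := hP w hw
    rwa [div_mul_eq_mul_div, le_div_iff₀ hn0, ← hE] at this) hG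
  have hfin : dimH (levelSet (α : EReal)) ≠ ⊤ :=
    ((dimH_mono (subset_univ _)).trans_lt (by rw [Real.dimH_univ]; exact ENNReal.one_lt_top)).ne
  exact (ENNReal.ofReal_le_iff_le_toReal hfin).1 hdim

/-- Main Theorem, upper tail: for every `n ≥ 1` and every `α > 2γ + 16/n`, the Lebesgue
measure of the set of irrational `x ∈ (0,1)` with `(2/n) log q_n(x) ≥ α` is at most
`C_α e^{-I(α) n}` with `C_α = e^{16(|I'(α)|+1)}`. -/
theorem main_upper_tail (n : ℕ) (hn : 1 ≤ n) (α : ℝ)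
    (hα : 2 * levyConst + 16 / (n : ℝ) < α) :
    volume {x : ℝ | x ∈ Set.Ioo (0 : ℝ) 1 ∧ Irrational x ∧
        α ≤ 2 / (n : ℝ) * Real.log (qDen n x)} ≤
      ENNReal.ofReal
        (Real.exp (16 * (|deriv rateI α| + 1)) * Real.exp (-(rateI α) * (n : ℝ))) := by
  set S : Set ℝ := {x : ℝ | x ∈ Set.Ioo (0 : ℝ) 1 ∧ Irrational x ∧
    α ≤ 2 / (n : ℝ) * Real.log (qDen n x)}
  have hn0 : (0 : ℝ) < n := by positivity
  have hα' : 2 * levyConst < α := lt_of_le_of_lt (le_add_of_nonneg_right (by positivity)) hα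
  have hα0 : 0 < α := by linarith [levyConst_pos]
  have hS1 : volume S ≤ 1 :=
    (measure_mono fun x hx => hx.1).trans (by rw [Real.volume_Ioo]; simp)
  have hfin : volume S ≠ ⊤ := (hS1.trans_lt ENNReal.one_lt_top).ne
  rcases eq_or_ne (volume S) 0 with h0 | h0
  · rw [h0]
    exact zero_le
  set M : ℝ := (volume S).toReal
  have hM : 0 < M := ENNReal.toReal_pos h0 hfin
  have hlog : Real.log M ≤ 0 := Real.log_nonpos hM.le (ENNReal.toReal_le_of_le_ofReal one_pos.le
    (by simpa using hS1))
  set s : ℝ := (16 - Real.log M) / (α * n)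
  have hs : s * α * n = 16 - Real.log M := by
    simp only [s]
    field_simp
  have hdim : 1 - s ≤ dimSpec α := by
    refine one_sub_le_dimSpec hn hα' (div_pos (by linarith) (by positivity)) ?_
    rw [ENNReal.ofReal_lt_iff_lt_toReal (by positivity) hfin, hs,
      show -(16 - Real.log M) = -16 + Real.log M by ring, Real.exp_add, Real.exp_log hM,
      ← mul_assoc]
    refine mul_lt_of_lt_one_left hM ?_
    rw [Real.exp_neg, ← div_eq_mul_inv, div_lt_one (Real.exp_pos _)]
    linarith [Real.add_one_le_exp (16 : ℝ)]
  rw [ENNReal.le_ofReal_iff_toReal_le hfin (by positivity), ← Real.exp_add]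
  rw [← Real.log_le_iff_le_exp hM]
  have hrate : rateI α * n ≤ s * α * n := by
    rw [rateI, mul_comm s α]
    gcongr
    linarith
  linarith [abs_nonneg (deriv rateI α)]
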